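/- Define f = (f^1, f^2, f^3) : ℝ^4 ∖ {0} → ℝ^3 (the Lawson–Osserman cone) by f(x) = (√5 / (2|x|)) · (x_1² + x_2² − x_3² − x_4², 2(x_1x_3 + x_2x_4), 2(x_2x_3 − x_1x_4)), where |x| = (x_1²+x_2²+x_3²+x_4²)^{1/2}. Let g(x) = I_4 + Df(x)ᵀ Df(x), i.e. g_{ij}(x) = δ_{ij} + Σ_{α=1}^3 ∂f^α/∂x^i (x) ∂f^α/∂x^j (x). Then for every x ≠ 0 the eigenvalues of the symmetric matrix g(x), counted with multiplicity, are 9/4, 6, 6 and 1; equivalently, the characteristic polynomial of g(x) is (X − 9/4)(X − 6)²(X − 1). In particular, the cosines of the Jordan angles between the tangent plane of the graph of f at (x, f(x)) and the coordinate 4-plane ℝ^4 × {0} are 2/3, √6/6, √6/6 and 1, independently of x. -/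

import Mathlib

noncomputable section

open scoped BigOperators

/-- Partial derivative of a scalar function on `ℝ^n` in the `i`-th coordinate direction. -/
def pderiv' {n : ℕ} (i : Fin n) (φ : (Fin n → ℝ) → ℝ) (x : Fin n → ℝ) : ℝ :=
  fderiv ℝ φ x (Pi.single i 1)

/-- The induced metric `g_{ij} = δ_{ij} + Σ_α ∂f^α/∂x^i ∂f^α/∂x^j` of the graph of `f`. -/
def graphMetric {n m : ℕ} (f : (Fin n → ℝ) → (Fin m → ℝ)) (x : Fin n → ℝ) :
    Matrix (Fin n) (Fin n) ℝ :=
  Matrix.of fun i j => (if i = j then (1 : ℝ) else 0) +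
    ∑ α : Fin m, pderiv' i (fun y => f y α) x * pderiv' j (fun y => f y α) x

/-- The Euclidean norm `|x| = (x₁² + x₂² + x₃² + x₄²)^{1/2}` on `ℝ⁴`. -/
def euclNorm4 (x : Fin 4 → ℝ) : ℝ :=
  Real.sqrt (x 0 ^ 2 + x 1 ^ 2 + x 2 ^ 2 + x 3 ^ 2)

/-- The Hopf map `ε : ℝ⁴ → ℝ³`. -/
def hopfMap (x : Fin 4 → ℝ) : Fin 3 → ℝ :=
  ![x 0 ^ 2 + x 1 ^ 2 - x 2 ^ 2 - x 3 ^ 2,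
    2 * (x 0 * x 2 + x 1 * x 3),
    2 * (x 1 * x 2 - x 0 * x 3)]

/-- The Lawson–Osserman cone map `f(x) = (Real.sqrt 5 / (2|x|)) · ε(x)`. -/
def LOmap (x : Fin 4 → ℝ) : Fin 3 → ℝ :=
  fun α => Real.sqrt 5 / (2 * euclNorm4 x) * hopfMap x α

open Polynomial

/-- The Jacobian of the Hopf map. -/
def hopfJacobian (x : Fin 4 → ℝ) : Matrix (Fin 3) (Fin 4) ℝ :=
  !![2 * x 0, 2 * x 1, -(2 * x 2), -(2 * x 3);
     2 * x 2, 2 * x 3, 2 * x 0, 2 * x 1;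
     -(2 * x 3), 2 * x 2, 2 * x 1, -(2 * x 0)]

/-- An orthogonal frame whose first column is `x` and whose last column is tangent to the Hopf
fibre through `x`. -/
def hopfFrame (x : Fin 4 → ℝ) : Matrix (Fin 4) (Fin 4) ℝ :=
  !![x 0, -x 2, -x 3, -x 1;
     x 1, x 3, -x 2, x 0;
     x 2, x 0, x 1, -x 3;
     x 3, -x 1, x 0, x 2]

theorem sq_sum_pos_of_ne_zero {x : Fin 4 → ℝ} (hx : x ≠ 0) :
    0 < x 0 ^ 2 + x 1 ^ 2 + x 2 ^ 2 + x 3 ^ 2 := by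
  obtain ⟨i, hi⟩ := Function.ne_iff.mp hx
  have h : 0 < x i ^ 2 := sq_pos_of_ne_zero hi
  fin_cases i <;> simp at h <;> positivity

theorem euclNorm4_sq (x : Fin 4 → ℝ) :
    euclNorm4 x ^ 2 = x 0 ^ 2 + x 1 ^ 2 + x 2 ^ 2 + x 3 ^ 2 :=
  Real.sq_sqrt (by positivity)

theorem euclNorm4_pos {x : Fin 4 → ℝ} (hx : x ≠ 0) : 0 < euclNorm4 x :=
  Real.sqrt_pos.mpr (sq_sum_pos_of_ne_zero hx)

theorem hasFDerivAt_hopfMap (x : Fin 4 → ℝ) (α : Fin 3) :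
    HasFDerivAt (fun y => hopfMap y α)
      (∑ i, hopfJacobian x α i • ContinuousLinearMap.proj (R := ℝ) (φ := fun _ => ℝ) i) x := by
  have h (i : Fin 4) : HasFDerivAt (fun y : Fin 4 → ℝ => y i)
    (ContinuousLinearMap.proj (R := ℝ) (φ := fun _ => ℝ) i) x := hasFDerivAt_apply i x
  fin_cases α
  · refine (((((h 0).pow 2).add ((h 1).pow 2)).sub ((h 2).pow 2)).sub
      ((h 3).pow 2)).congr_fderiv ?_
    ext v
    simp [hopfJacobian, Fin.sum_univ_four]
    ring
  · refine ((((h 0).mul (h 2)).add ((h 1).mul (h 3))).const_mul 2).congr_fderiv ?_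
    ext v
    simp [hopfJacobian, Fin.sum_univ_four]
    ring
  · refine ((((h 1).mul (h 2)).sub ((h 0).mul (h 3))).const_mul 2).congr_fderiv ?_
    ext v
    simp [hopfJacobian, Fin.sum_univ_four]
    ring

theorem hasFDerivAt_euclNorm4 {x : Fin 4 → ℝ} (hx : x ≠ 0) :
    HasFDerivAt euclNorm4
      (∑ i, (x i / euclNorm4 x) • ContinuousLinearMap.proj (R := ℝ) (φ := fun _ => ℝ) i) x := by
  have h (i : Fin 4) : HasFDerivAt (fun y : Fin 4 → ℝ => y i)
    (ContinuousLinearMap.proj (R := ℝ) (φ := fun _ => ℝ) i) x := hasFDerivAt_apply i x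
  refine ((((((h 0).pow 2).add ((h 1).pow 2)).add ((h 2).pow 2)).add
    ((h 3).pow 2)).sqrt (sq_sum_pos_of_ne_zero hx).ne').congr_fderiv ?_
  have hr := (euclNorm4_pos hx).ne'
  ext v
  simp [Fin.sum_univ_four, ← euclNorm4.eq_1]
  field_simp

theorem pderiv'_LOmap {x : Fin 4 → ℝ} (hx : x ≠ 0) (i : Fin 4) (α : Fin 3) :
    pderiv' i (fun y => LOmap y α) x =
      Real.sqrt 5 / (2 * euclNorm4 x) * (hopfJacobian x α i - x i * hopfMap x α / euclNorm4 x ^ 2) := by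
  have hr := (euclNorm4_pos hx).ne'
  have h := (((hasDerivAt_inv (mul_ne_zero two_ne_zero hr)).comp_hasFDerivAt x
    ((hasFDerivAt_euclNorm4 hx).const_mul 2)).const_mul (Real.sqrt 5)).mul (hasFDerivAt_hopfMap x α)
  have h' := congrArg (fun L => L (Pi.single i 1)) h.fderiv
  refine h'.trans ?_
  simp [Pi.single_apply]
  field_simp
  ring

theorem hopfFrame_mul_transpose (x : Fin 4 → ℝ) :
    hopfFrame x * (hopfFrame x).transpose = (euclNorm4 x ^ 2) • (1 : Matrix (Fin 4) (Fin 4) ℝ) := by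
  rw [euclNorm4_sq]
  ext i j
  fin_cases i <;> fin_cases j <;>
    simp [hopfFrame, Matrix.mul_apply, Fin.sum_univ_four] <;> ring

theorem graphMetric_LOmap {x : Fin 4 → ℝ} (hx : x ≠ 0) :
    graphMetric LOmap x = hopfFrame x * Matrix.diagonal ![9 / 4, 6, 6, 1] *
      ((euclNorm4 x ^ 2)⁻¹ • (hopfFrame x).transpose) := by
  have hs := (sq_sum_pos_of_ne_zero hx).ne'
  have key (i j : Fin 4) (α : Fin 3) :
      pderiv' i (fun y => LOmap y α) x * pderiv' j (fun y => LOmap y α) x =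
        5 / (4 * euclNorm4 x ^ 2) *
          ((hopfJacobian x α i - x i * hopfMap x α / euclNorm4 x ^ 2) *
          (hopfJacobian x α j - x j * hopfMap x α / euclNorm4 x ^ 2)) := by
    rw [pderiv'_LOmap hx, pderiv'_LOmap hx, mul_mul_mul_comm, div_mul_div_comm,
      Real.mul_self_sqrt (by norm_num)]
    ring
  ext i j
  simp only [graphMetric, Matrix.of_apply, key, euclNorm4_sq]
  fin_cases i <;> fin_cases j <;>
    simp [hopfFrame, hopfJacobian, hopfMap, Matrix.mul_apply, Fin.sum_univ_four,
      Fin.sum_univ_three, Matrix.vecMul_diagonal] <;> field_simp <;> ring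

/-- **Eigenvalues of the Lawson–Osserman graph metric** (Appendix): for every `x ≠ 0`
the eigenvalues of `g(x) = I₄ + Df(x)ᵀDf(x)`, counted with multiplicity, are
`9/4, 6, 6, 1`; equivalently its characteristic polynomial is
`(X − 9/4)(X − 6)²(X − 1)`. Hence the cosines of the Jordan angles between the tangent
plane of the graph and the coordinate 4-plane are `2/3, √6/6, √6/6, 1`. -/
theorem lawson_osserman_charpoly (x : Fin 4 → ℝ) (hx : x ≠ 0) :
    (graphMetric LOmap x).charpoly =
      (X - C (9 / 4)) * (X - C 6) ^ 2 * (X - C 1) := by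
  have hr : euclNorm4 x ^ 2 ≠ 0 := pow_ne_zero 2 (euclNorm4_pos hx).ne'
  have hinv : ((euclNorm4 x ^ 2)⁻¹ • (hopfFrame x).transpose) * hopfFrame x = 1 := by
    rw [mul_eq_one_comm, Matrix.mul_smul, hopfFrame_mul_transpose, inv_smul_smul₀ hr]
  rw [graphMetric_LOmap hx, Matrix.charpoly_mul_comm, ← Matrix.mul_assoc, hinv, Matrix.one_mul,
    Matrix.charpoly_diagonal]
  simp only [Fin.prod_univ_four, Matrix.cons_val]
  ring
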